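/- Let L/K be a finite Galois extension of complete discrete valuation fields with perfect residue fields, and let M be the subfield of L fixed by Gal(L/K)^{(u_{L/K})}. Then L/K satisfies Fontaine's property (P_m) for m = u_{L/K} if and only if L/M satisfies (P_m) for m = u_{L/M}. -/

import Mathlib

noncomputable section

open scoped Classical

set_option synthInstance.maxHeartbeats 400000

namespace Fontaine

/-! ### The ambient setting

`K` is a field, `Ω` a fixed algebraic closure of `K`, and `v : Ω → ℝ` is (the unique)
additive valuation on `Ω` extending the normalized discrete valuation of `K`
(so that `v (K^×) = ℤ`), with `K` complete.  Algebraic extensions `E / K` are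
intermediate fields of `Ω / K`. -/

/-- `v` is an additive valuation on `Ω`, extending the normalized discrete valuation
of the complete field `K` (the value of `v` at `0` is irrelevant junk). The
Galois-invariance and completeness clauses are true (and uniquely determining)
properties of this situation. -/
structure IsCDV (K Ω : Type) [Field K] [Field Ω] [Algebra K Ω] (v : Ω → ℝ) : Prop where
  map_mul : ∀ x y : Ω, x ≠ 0 → y ≠ 0 → v (x * y) = v x + v y
  add_ge : ∀ x y : Ω, x ≠ 0 → y ≠ 0 → x + y ≠ 0 → min (v x) (v y) ≤ v (x + y)
  int_valued : ∀ x : K, x ≠ 0 → ∃ n : ℤ, v (algebraMap K Ω x) = (n : ℝ)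
  exists_uniformizer : ∃ x : K, v (algebraMap K Ω x) = 1
  galois_inv : ∀ (E : IntermediateField K Ω) (σ : ↥E ≃ₐ[K] ↥E) (x : ↥E),
    v ((σ x : Ω)) = v (x : Ω)
  complete : ∀ x : ℕ → K,
    (∀ N : ℝ, ∃ n₀ : ℕ, ∀ i j : ℕ, n₀ ≤ i → n₀ ≤ j →
      x i = x j ∨ N ≤ v (algebraMap K Ω (x i - x j))) →
    ∃ y : K, ∀ N : ℝ, ∃ n₀ : ℕ, ∀ i : ℕ, n₀ ≤ i →
      x i = y ∨ N ≤ v (algebraMap K Ω (x i - y))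

variable {K Ω : Type} [Field K] [Field Ω] [Algebra K Ω] (v : Ω → ℝ)

/-- `x` belongs to the ring of integers `O_E` of `E`. -/
def IsInt (E : IntermediateField K Ω) (x : Ω) : Prop :=
  x ∈ E ∧ (x = 0 ∨ 0 ≤ v x)

/-- The minimal positive value of `v` on `F`; it equals `1 / e_{F/K}`. -/
def minVal (F : IntermediateField K Ω) : ℝ :=
  sInf {r : ℝ | 0 < r ∧ ∃ x ∈ F, v x = r}

/-- The ramification index `e_{F/K}`. -/
def ramIdx (F : IntermediateField K Ω) : ℝ := (minVal v F)⁻¹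

/-- The valuation normalized with respect to the base field `F`
(so that `vRel v F (F^×) = ℤ`); this is `v_F`. -/
def vRel (F : IntermediateField K Ω) (x : Ω) : ℝ := v x * ramIdx v F

/-- `x` lies in the ideal `a_{E/F}^m = {x ∈ O_E : v_F x ≥ m}` (valuation condition). -/
def InId (F : IntermediateField K Ω) (m : ℝ) (x : Ω) : Prop :=
  x = 0 ∨ m ≤ vRel v F x

/-- `f : Ω → Ω` is a set-theoretic representative of an `O_F`-algebra homomorphism
`O_L → O_E / a_{E/F}^m`. -/
def IsHomMod (F L E : IntermediateField K Ω) (m : ℝ) (f : Ω → Ω) : Prop :=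
  (∀ x, IsInt v L x → IsInt v E (f x)) ∧
  (∀ x y, IsInt v L x → IsInt v L y → InId v F m (f (x + y) - (f x + f y))) ∧
  (∀ x y, IsInt v L x → IsInt v L y → InId v F m (f (x * y) - f x * f y)) ∧
  InId v F m (f 1 - 1) ∧
  (∀ c, IsInt v F c → InId v F m (f c - c))

/-- There exists an `O_F`-algebra homomorphism `O_L → O_E / a_{E/F}^m`. -/
def HomMod (F L E : IntermediateField K Ω) (m : ℝ) : Prop :=
  ∃ f : Ω → Ω, IsHomMod v F L E m f

/-- Fontaine's property (P_m) for the extension `L / F`. -/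
def PropP (F L : IntermediateField K Ω) (m : ℝ) : Prop :=
  ∀ E : IntermediateField K Ω, F ≤ E → HomMod v F L E m → L ≤ E

/-- `E / F` is totally ramified: the residue extension is trivial. -/
def TotRam (F E : IntermediateField K Ω) : Prop :=
  ∀ x, IsInt v E x → ∃ c, c ∈ F ∧ (c = 0 ∨ 0 ≤ v c) ∧ (x - c = 0 ∨ 0 < v (x - c))

/-- Property (P_m^tr) for `L / F`: (P_m) restricted to totally ramified `E / F`. -/
def PropPtr (F L : IntermediateField K Ω) (m : ℝ) : Prop :=
  ∀ E : IntermediateField K Ω, F ≤ E → TotRam v F E → HomMod v F L E m → L ≤ E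

/-- `E / F` is unramified: `F ≤ E` and the value group does not grow
(the residue fields being perfect, this is the usual notion). -/
def Unram (F E : IntermediateField K Ω) : Prop :=
  F ≤ E ∧ ∀ x : Ω, x ∈ E → x ≠ 0 → ∃ n : ℤ, vRel v F x = (n : ℝ)

/-- The elements of `Gal(L/K)` fixing `F` pointwise, i.e. `Gal(L/F)`. -/
def relGal (F L : IntermediateField K Ω) : Set (↥L ≃ₐ[K] ↥L) :=
  {σ | ∀ x : ↥L, (x : Ω) ∈ F → σ x = x}

/-- `σ` lies in the ramification group `Gal(L/F)_{(i)}` in Fontaine's lower numbering: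
`σ ∈ Gal(L/F)` and `v_F (σ x - x) ≥ i` for all integers `x` of `L`. -/
def lowerAt (F L : IntermediateField K Ω) (σ : ↥L ≃ₐ[K] ↥L) (i : ℝ) : Prop :=
  σ ∈ relGal F L ∧
    ∀ x : ↥L, IsInt v L (x : Ω) → (σ x = x ∨ i ≤ vRel v F ((σ x : Ω) - (x : Ω)))

/-- Fontaine's function `i_{L/F}(σ) = min_{x ∈ O_L} v_F (σ x - x)`. -/
def iFon (F L : IntermediateField K Ω) (σ : ↥L ≃ₐ[K] ↥L) : ℝ :=
  sSup {i : ℝ | lowerAt v F L σ i}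

/-- `i_{L/F}`: the largest `i` with `Gal(L/F)_{(i)}` nontrivial. -/
def iBreak (F L : IntermediateField K Ω) : ℝ :=
  sSup {i : ℝ | ∃ σ : ↥L ≃ₐ[K] ↥L, σ ≠ 1 ∧ lowerAt v F L σ i}

/-- Fontaine's Herbrand function `φ̃_{L/F}(t) = t + ∑_{1 ≠ σ ∈ Gal(L/F)} min (i_{L/F}(σ)) t`
(valid for `t ≥ 0` when the residue extension is separable). -/
def phiT (F L : IntermediateField K Ω) (t : ℝ) : ℝ :=
  t + ∑ᶠ σ ∈ {σ : ↥L ≃ₐ[K] ↥L | σ ∈ relGal F L ∧ σ ≠ 1}, min (iFon v F L σ) t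

/-- The maximal upper ramification break `u_{L/F} = φ̃_{L/F}(i_{L/F})`
(in Fontaine's numbering). -/
def uBreak (F L : IntermediateField K Ω) : ℝ := phiT v F L (iBreak v F L)

/-- Fontaine's inverse Herbrand function `ψ̃_{L/F}`. -/
def psiT (F L : IntermediateField K Ω) (u : ℝ) : ℝ :=
  sInf {t : ℝ | 0 ≤ t ∧ u ≤ phiT v F L t}

/-- Serre's inverse Herbrand function `ψ_{L/K}(u) = e_{L/K} ψ̃_{L/K}(u+1) - 1`. -/
def serrePsi (L : IntermediateField K Ω) (u : ℝ) : ℝ :=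
  ramIdx v L * psiT v ⊥ L (u + 1) - 1

/-- `L/K` has a unique jump in the ramification filtration of its Galois group:
`Gal(L/K)^{(u)} = Gal(L/K)` for all `u ≤ u_{L/K}`; equivalently, all
`i_{L/K}(σ)`, `σ ≠ 1`, are equal to `i_{L/K}`. -/
def UniqueJump (L : IntermediateField K Ω) : Prop :=
  ∀ σ : ↥L ≃ₐ[K] ↥L, σ ≠ 1 → iFon v ⊥ L σ = iBreak v ⊥ L

/-- The fixed field `M` of `Gal(L/K)^{(u_{L/K})} = Gal(L/K)_{(i_{L/K})}` inside `L`,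
as an intermediate field of `Ω / K`. -/
def ramFixed (L : IntermediateField K Ω) : IntermediateField K Ω where
  carrier := {x : Ω | ∃ hx : x ∈ L, ∀ σ : ↥L ≃ₐ[K] ↥L,
    lowerAt v ⊥ L σ (iBreak v ⊥ L) → σ ⟨x, hx⟩ = ⟨x, hx⟩}
  mul_mem' := by
    rintro a b ⟨ha, pa⟩ ⟨hb, pb⟩
    refine ⟨mul_mem ha hb, fun σ hσ => ?_⟩
    have h : (⟨a * b, mul_mem ha hb⟩ : ↥L) = ⟨a, ha⟩ * ⟨b, hb⟩ := rfl
    rw [h, map_mul, pa σ hσ, pb σ hσ]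
  one_mem' := by
    refine ⟨one_mem L, fun σ hσ => ?_⟩
    have h : (⟨(1 : Ω), one_mem L⟩ : ↥L) = 1 := rfl
    rw [h, map_one]
  add_mem' := by
    rintro a b ⟨ha, pa⟩ ⟨hb, pb⟩
    refine ⟨add_mem ha hb, fun σ hσ => ?_⟩
    have h : (⟨a + b, add_mem ha hb⟩ : ↥L) = ⟨a, ha⟩ + ⟨b, hb⟩ := rfl
    rw [h, map_add, pa σ hσ, pb σ hσ]
  zero_mem' := by
    refine ⟨zero_mem L, fun σ hσ => ?_⟩
    have h : (⟨(0 : Ω), zero_mem L⟩ : ↥L) = 0 := rfl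
    rw [h, map_zero]
  algebraMap_mem' := by
    intro r
    refine ⟨IntermediateField.algebraMap_mem L r, fun σ hσ => ?_⟩
    have h : (⟨algebraMap K Ω r, IntermediateField.algebraMap_mem L r⟩ : ↥L)
        = algebraMap K ↥L r := rfl
    rw [h, AlgEquiv.commutes]
  inv_mem' := by
    rintro a ⟨ha, pa⟩
    refine ⟨IntermediateField.inv_mem L ha, fun σ hσ => ?_⟩
    have h : (⟨a⁻¹, IntermediateField.inv_mem L ha⟩ : ↥L) = (⟨a, ha⟩ : ↥L)⁻¹ := by
      apply Subtype.ext
      rw [IntermediateField.coe_inv]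
    rw [h, map_inv₀, pa σ hσ]

section Res

variable {Ω : Type} [Field Ω] (v : Ω → ℝ) (K : Type) [Field K] [Algebra K Ω]

/-- `x ∈ K` is an integer of `K`. -/
def IsIntK (x : K) : Prop := x = 0 ∨ 0 ≤ v (algebraMap K Ω x)

/-- The residue field of `K` has characteristic `p`. -/
def ResidueCharP (p : ℕ) : Prop :=
  (p : K) = 0 ∨ 0 < v (algebraMap K Ω (p : K))

/-- The Frobenius of the residue field of `K` at `p` is surjective. -/
def PerfectResidueAt (p : ℕ) : Prop :=
  ∀ x : K, IsIntK v K x → ∃ y : K, IsIntK v K y ∧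
    (x - y ^ p = 0 ∨ 0 < v (algebraMap K Ω (x - y ^ p)))

/-- The residue field of `K` is perfect. -/
def PerfectResidue : Prop :=
  ∀ p : ℕ, p.Prime → ResidueCharP v K p → PerfectResidueAt v K p

/-- The residue field of `K` is algebraically closed. -/
def ResidueAlgClosed : Prop :=
  ∀ q : Polynomial K, q.Monic → 0 < q.natDegree → (∀ i, IsIntK v K (q.coeff i)) →
    ∃ x : K, IsIntK v K x ∧
      (Polynomial.eval x q = 0 ∨ 0 < v (algebraMap K Ω (Polynomial.eval x q)))

/-- `ρ : K → k` realizes `k` as the residue field of `K`: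
on the integers of `K` it is the residue (reduction) map. -/
def IsResidueMap {k : Type} [Field k] (ρ : K → k) : Prop :=
  (∀ x y : K, IsIntK v K x → IsIntK v K y → ρ (x + y) = ρ x + ρ y) ∧
  (∀ x y : K, IsIntK v K x → IsIntK v K y → ρ (x * y) = ρ x * ρ y) ∧
  ρ 1 = 1 ∧
  (∀ a : k, ∃ x : K, IsIntK v K x ∧ ρ x = a) ∧
  (∀ x : K, IsIntK v K x → (ρ x = 0 ↔ (x = 0 ∨ 0 < v (algebraMap K Ω x))))

/-- The group `U_K^n` of `n`-th principal units of `K` (for `n ≥ 1`),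
as a subgroup of `Kˣ`. -/
def prinK (n : ℝ) : Subgroup Kˣ :=
  Subgroup.closure {u : Kˣ | (u : K) = 1 ∨ n ≤ v (algebraMap K Ω ((u : K) - 1))}

end Res

/-- The group `U_E^n` of `n`-th principal units of an intermediate field `E`
(for `n ≥ 1`), with respect to the normalized valuation `v_E` of `E`,
as a subgroup of `(↥E)ˣ`. -/
def prinE {K Ω : Type} [Field K] [Field Ω] [Algebra K Ω] (v : Ω → ℝ)
    (E : IntermediateField K Ω) (n : ℝ) : Subgroup (↥E)ˣ :=
  Subgroup.closure {u : (↥E)ˣ | ((u : ↥E) : Ω) = 1 ∨ n ≤ vRel v E (((u : ↥E) : Ω) - 1)}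

end Fontaine

open Fontaine

open Polynomial IsLocalRing in
theorem residue_aeval {A B : Type*} [CommRing A] [IsLocalRing A] [CommRing B] [IsLocalRing B]
    [Algebra A B] [IsLocalHom (algebraMap A B)] (β : B) (g : A[X]) :
    residue B (aeval β g) = aeval (residue B β) (g.map (residue A)) := by
  simp only [aeval_def, eval₂_map, hom_eval₂]
  rfl

open Polynomial IsLocalRing in
/-- Polynomials in `α` approximate every element modulo powers of a principal maximal ideal, as soon
as they contain a generator of that ideal and `α` generates the residue field. -/
theorem exists_mem_adjoin_sub_mem_maximalIdeal_pow {A B : Type*} [CommRing A] [IsLocalRing A]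
    [CommRing B] [IsLocalRing B] [Algebra A B] [IsLocalHom (algebraMap A B)] {α ϖ : B}
    (hα : Algebra.adjoin (ResidueField A) {residue B α} = ⊤)
    (hϖ : maximalIdeal B = Ideal.span {ϖ}) (hϖα : ϖ ∈ Algebra.adjoin A {α}) (n : ℕ) (x : B) :
    ∃ s ∈ Algebra.adjoin A {α}, x - s ∈ maximalIdeal B ^ n := by
  induction n generalizing x with
  | zero => exact ⟨0, zero_mem _, by simp⟩
  | succ n ih =>
    obtain ⟨s, hs, hxs⟩ := ih x
    rw [hϖ, Ideal.span_singleton_pow, Ideal.mem_span_singleton] at hxs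
    obtain ⟨y, hy⟩ := hxs
    have hmem : residue B y ∈ Algebra.adjoin (ResidueField A) {residue B α} := hα ▸ trivial
    rw [Algebra.adjoin_singleton_eq_range_aeval] at hmem
    obtain ⟨p, hp⟩ := hmem
    obtain ⟨q, rfl⟩ := Polynomial.map_surjective (residue A) residue_surjective p
    have hq : residue B (aeval α q) = residue B y := (residue_aeval α q).trans hp
    have hyq : y - aeval α q ∈ maximalIdeal B := by
      rw [← residue_eq_zero_iff, map_sub, hq, sub_self]
    refine ⟨s + ϖ ^ n * aeval α q, add_mem hs (mul_mem (pow_mem hϖα n)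
      (aeval_mem_adjoin_singleton A α)), ?_⟩
    have : x - (s + ϖ ^ n * aeval α q) = ϖ ^ n * (y - aeval α q) := by linear_combination hy
    rw [this, pow_succ]
    exact Ideal.mul_mem_mul (Ideal.pow_mem_pow (hϖ ▸ Ideal.mem_span_singleton_self ϖ) n) hyq

open Polynomial IsLocalRing in
/-- A finite local extension with principal maximal ideal and separable residue extension is
monogenic. -/
theorem exists_adjoin_singleton_eq_top {A B : Type*} [CommRing A] [IsLocalRing A]
    [CommRing B] [IsLocalRing B] [Algebra A B] [IsLocalHom (algebraMap A B)] [Module.Finite A B]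
    [Algebra.IsSeparable (ResidueField A) (ResidueField B)] {ϖ : B}
    (hϖ : maximalIdeal B = Ideal.span {ϖ}) {n : ℕ}
    (hn : maximalIdeal B ^ n ≤ (maximalIdeal A).map (algebraMap A B)) :
    ∃ α : B, Algebra.adjoin A {α} = ⊤ := by
  obtain ⟨a, ha⟩ := Field.exists_primitive_element (ResidueField A) (ResidueField B)
  have haint : IsIntegral (ResidueField A) a := Algebra.IsIntegral.isIntegral a
  have ha' : Algebra.adjoin (ResidueField A) {a} = ⊤ := by
    rw [← IntermediateField.adjoin_simple_toSubalgebra_of_isAlgebraic haint.isAlgebraic, ha]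
    rfl
  obtain ⟨β, rfl⟩ := residue_surjective a
  obtain ⟨f, hf⟩ := Polynomial.map_surjective (residue A) residue_surjective
    (minpoly (ResidueField A) (residue B β))
  have hroot : aeval β f ∈ maximalIdeal B := by
    rw [← residue_eq_zero_iff, residue_aeval, hf, minpoly.aeval]
  have hder : IsUnit (aeval β (derivative f)) := by
    by_contra h
    rw [← mem_nonunits_iff, ← mem_maximalIdeal, ← residue_eq_zero_iff, residue_aeval,
      ← derivative_map,
      hf] at h
    exact (Algebra.IsSeparable.isSeparable (ResidueField A)
      (residue B β)).aeval_derivative_ne_zero (minpoly.aeval _ _) h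
  have hϖmem : ϖ ∈ maximalIdeal B := hϖ ▸ Ideal.mem_span_singleton_self ϖ
  obtain ⟨α, hα, ψ, hψ, hψα⟩ : ∃ α : B, residue B α = residue B β ∧
      ∃ ψ, maximalIdeal B = Ideal.span {ψ} ∧ ψ ∈ Algebra.adjoin A {α} := by
    obtain ⟨t, ht⟩ := Ideal.mem_span_singleton.mp (hϖ ▸ hroot)
    by_cases htu : IsUnit t
    · refine ⟨β, rfl, aeval β f, ?_, aeval_mem_adjoin_singleton A β⟩
      rw [ht, Ideal.span_singleton_mul_right_unit htu, hϖ]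
    · refine ⟨β + ϖ, ?_, aeval (β + ϖ) f, ?_, aeval_mem_adjoin_singleton A _⟩
      · rw [map_add, (residue_eq_zero_iff ϖ).mpr hϖmem, add_zero]
      · obtain ⟨c, hc⟩ := (f.map (algebraMap A B)).binomExpansion β ϖ
        have hexp : aeval (β + ϖ) f = ϖ * (aeval β (derivative f) + (t + c * ϖ)) := by
          simp only [eval_map_algebraMap, derivative_map] at hc
          rw [hc, ht]; ring
        have hu : IsUnit (aeval β (derivative f) + (t + c * ϖ)) := by
          by_contra h
          have h1 : t + c * ϖ ∈ maximalIdeal B :=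
            add_mem ((mem_maximalIdeal t).mpr htu) (Ideal.mul_mem_left _ _ hϖmem)
          have h2 := sub_mem ((mem_maximalIdeal _).mpr h) h1
          rw [add_sub_cancel_right] at h2
          exact (mem_maximalIdeal _).mp h2 hder
        rw [hexp, Ideal.span_singleton_mul_right_unit hu, hϖ]
  refine ⟨α, ?_⟩
  rw [← Algebra.toSubmodule_eq_top, eq_top_iff]
  refine Submodule.le_of_le_smul_of_le_jacobson_bot (I := maximalIdeal A) Module.Finite.fg_top
    (maximalIdeal_le_jacobson _) fun x _ => ?_
  obtain ⟨s, hs, hxs⟩ := exists_mem_adjoin_sub_mem_maximalIdeal_pow (A := A) (hα ▸ ha') hψ hψα n x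
  rw [← add_sub_cancel s x]
  refine Submodule.add_mem_sup hs ?_
  rw [Ideal.smul_top_eq_map]
  exact hn hxs

/-- The ring of integers of an additive valuation. -/
def addValInts {F : Type*} [Field F] (w : AddValuation F (WithTop ℝ)) : ValuationSubring F where
  carrier := {x | 0 ≤ w x}
  mul_mem' {x y} hx hy := by
    simp only [Set.mem_ofPred_eq, w.map_mul] at *
    exact add_nonneg hx hy
  one_mem' := w.map_one.ge
  add_mem' hx hy := w.map_le_add hx hy
  zero_mem' := by simp
  neg_mem' {x} hx := by simpa using hx
  mem_or_inv_mem' x := by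
    by_cases hx : x = 0
    · left; simp [hx]
    · have h : w x + w x⁻¹ = 0 := by rw [← w.map_mul, mul_inv_cancel₀ hx, w.map_one]
      rcases le_total 0 (w x) with h0 | h0
      · exact Or.inl h0
      · exact Or.inr (h ▸ add_le_of_nonpos_left h0)

section AddValInts

variable {F : Type*} [Field F] {w : AddValuation F (WithTop ℝ)}

theorem mem_addValInts {x : F} : x ∈ addValInts w ↔ 0 ≤ w x := Iff.rfl

theorem addValInts_dvd {x y : addValInts w} (hx : x ≠ 0) (h : w x ≤ w y) : x ∣ y := by
  have hx' : (x : F) ≠ 0 := by simpa using hx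
  obtain ⟨r, hr⟩ := WithTop.ne_top_iff_exists.mp (w.ne_top_iff.mpr hx')
  have hq : w (y / x : F) + w x = w y := by rw [← w.map_mul, div_mul_cancel₀ _ hx']
  have hmem : 0 ≤ w (y / x : F) := by
    rw [← hq, ← hr] at h
    exact (WithTop.add_le_add_iff_right (WithTop.coe_ne_top (a := r))).mp (by simpa using h)
  refine ⟨⟨y / x, hmem⟩, Subtype.ext ?_⟩
  simp only [MulMemClass.coe_mul]
  field_simp

theorem isUnit_addValInts_iff {x : addValInts w} : IsUnit x ↔ w x = 0 := by
  refine ⟨fun h => ?_, fun h => ?_⟩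
  · obtain ⟨y, hy⟩ := h.exists_right_inv
    have h1 : w x + w y = 0 := by
      rw [← w.map_mul, ← w.map_one]
      exact congrArg (fun z : addValInts w => w z) hy
    refine le_antisymm ?_ x.2
    rw [← h1]
    exact le_add_of_nonneg_right y.2
  · refine isUnit_iff_dvd_one.mpr (addValInts_dvd ?_ ?_)
    · rintro rfl
      simp at h
    · simp [h]

theorem mem_maximalIdeal_addValInts {x : addValInts w} :
    x ∈ IsLocalRing.maximalIdeal (addValInts w) ↔ 0 < w x := by
  rw [IsLocalRing.mem_maximalIdeal, mem_nonunits_iff, isUnit_addValInts_iff]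
  exact ⟨fun h => lt_of_le_of_ne x.2 (Ne.symm h), fun h => h.ne'⟩

theorem isPrincipalIdealRing_addValInts {d : ℕ} (hd : d ≠ 0)
    (h : ∀ x : F, x ≠ 0 → ∃ n : ℤ, d • w x = ((n : ℝ) : WithTop ℝ)) :
    IsPrincipalIdealRing (addValInts w) := by
  refine ⟨fun I => ?_⟩
  by_cases hI : I = ⊥
  · exact hI ▸ inferInstance
  have hnat (x : addValInts w) (hx : x ≠ 0) : ∃ n : ℕ, d • w x = ((n : ℝ) : WithTop ℝ) := by
    obtain ⟨n, hn⟩ := h x (by simpa using hx)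
    have h0 : 0 ≤ d • w x := nsmul_nonneg x.2 d
    rw [hn] at h0
    lift n to ℕ using by exact_mod_cast h0
    exact ⟨n, by simpa using hn⟩
  obtain ⟨z, hz, hz0⟩ := Submodule.exists_mem_ne_zero_of_ne_bot hI
  have hex : ∃ n : ℕ, ∃ x ∈ I, x ≠ 0 ∧ d • w x = ((n : ℝ) : WithTop ℝ) := by
    obtain ⟨n, hn⟩ := hnat z hz0
    exact ⟨n, z, hz, hz0, hn⟩
  obtain ⟨x, hx, hx0, hxn⟩ := Nat.find_spec hex
  refine ⟨x, le_antisymm (fun y hy => ?_) ((Ideal.span_singleton_le_iff_mem I).mpr hx)⟩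
  by_cases hy0 : y = 0
  · simp [hy0]
  obtain ⟨m, hm⟩ := hnat y hy0
  have hle : Nat.find hex ≤ m := Nat.find_min' hex ⟨y, hy, hy0, hm⟩
  refine Ideal.mem_span_singleton.mpr (addValInts_dvd hx0 ?_)
  have hle' : d • w x ≤ d • w y := by
    rw [hxn, hm]
    exact_mod_cast hle
  obtain ⟨r, hr⟩ := WithTop.ne_top_iff_exists.mp
    (w.ne_top_iff.mpr (show (x : F) ≠ 0 by simpa using hx0))
  obtain ⟨s, hs⟩ := WithTop.ne_top_iff_exists.mp
    (w.ne_top_iff.mpr (show (y : F) ≠ 0 by simpa using hy0))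
  rw [← hr, ← hs] at hle' ⊢
  norm_cast at hle' ⊢
  rw [nsmul_eq_mul, nsmul_eq_mul] at hle'
  exact le_of_mul_le_mul_left hle' (by positivity)

end AddValInts

section Monogenic

variable {F E : Type*} [Field F] [Field E] [Algebra F E] [FiniteDimensional F E]

open Polynomial in
/-- The polynomial whose roots are the conjugates of `α` over `M`. -/
def galoisPoly (M : IntermediateField F E) (α : E) : E[X] :=
  ∏ σ : M.fixingSubgroup, (X - C ((σ : E ≃ₐ[F] E) α))

open Polynomial in
theorem galoisPoly_monic (M : IntermediateField F E) (α : E) : (galoisPoly M α).Monic :=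
  monic_prod_of_monic _ _ fun _ _ => monic_X_sub_C _

open Polynomial in
theorem galoisPoly_eval_self (M : IntermediateField F E) (α : E) :
    (galoisPoly M α).eval α = 0 := by
  rw [galoisPoly, eval_prod]
  exact Finset.prod_eq_zero (Finset.mem_univ 1) (by simp)

variable {w : AddValuation E (WithTop ℝ)}

open Polynomial in
theorem galoisPoly_coeff_nonneg (hinv : ∀ (σ : E ≃ₐ[F] E) x, w (σ x) = w x)
    (M : IntermediateField F E) {α : E} (hα : 0 ≤ w α) (i : ℕ) :
    0 ≤ w ((galoisPoly M α).coeff i) := by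
  have : galoisPoly M α = (∏ σ : M.fixingSubgroup, (X - C (⟨(σ : E ≃ₐ[F] E) α,
      hα.trans_eq (hinv σ α).symm⟩ : addValInts w))).map (addValInts w).subtype := by
    rw [galoisPoly, Polynomial.map_prod]
    simp
  rw [this, coeff_map]
  exact mem_addValInts.mp (SetLike.coe_mem _)

variable [IsGalois F E]

theorem addVal_norm (hinv : ∀ (σ : E ≃ₐ[F] E) x, w (σ x) = w x) (x : E) :
    w (algebraMap F E (Algebra.norm F x)) = Nat.card (E ≃ₐ[F] E) • w x := by
  have hprod (s : Finset (E ≃ₐ[F] E)) : w (∏ σ ∈ s, σ x) = s.card • w x := by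
    induction s using Finset.induction_on with
    | empty => simp
    | insert σ s hσ ih =>
      rw [Finset.prod_insert hσ, w.map_mul, ih, hinv, Finset.card_insert_of_notMem hσ, succ_nsmul']
  rw [Algebra.norm_eq_prod_automorphisms, hprod, Finset.card_univ, Nat.card_eq_fintype_card]

theorem card_nsmul_eq_of_galois_inv (hinv : ∀ (σ : E ≃ₐ[F] E) x, w (σ x) = w x)
    (hint : ∀ x : F, x ≠ 0 → ∃ n : ℤ, w (algebraMap F E x) = ((n : ℝ) : WithTop ℝ))
    (x : E) (hx : x ≠ 0) : ∃ n : ℤ, Nat.card (E ≃ₐ[F] E) • w x = ((n : ℝ) : WithTop ℝ) := by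
  obtain ⟨n, hn⟩ := hint (Algebra.norm F x) (by simpa using hx)
  exact ⟨n, by rw [← hn, addVal_norm hinv]⟩

theorem IntermediateField.mem_of_fixingSubgroup_fixed {M : IntermediateField F E} {x : E}
    (h : ∀ σ ∈ M.fixingSubgroup, σ x = x) : x ∈ M := by
  rw [← IsGalois.fixedField_fixingSubgroup M]
  exact fun σ => h σ.1 σ.2

open Polynomial in
theorem galoisPoly_coeff_mem (M : IntermediateField F E) (α : E) (i : ℕ) :
    (galoisPoly M α).coeff i ∈ M := by
  refine IntermediateField.mem_of_fixingSubgroup_fixed fun τ hτ => ?_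
  have : (galoisPoly M α).map (τ : E →+* E) = galoisPoly M α := by
    rw [galoisPoly, Polynomial.map_prod]
    exact Fintype.prod_equiv (Equiv.mulLeft (⟨τ, hτ⟩ : M.fixingSubgroup)) _ _ (by simp)
  conv_rhs => rw [← this, coeff_map]
  rfl

open Polynomial in
theorem isIntegral_addValInts (hinv : ∀ (σ : E ≃ₐ[F] E) x, w (σ x) = w x)
    [Algebra (addValInts (w.comap (algebraMap F E))) E]
    (hA : ∀ a : addValInts (w.comap (algebraMap F E)), algebraMap _ E a = algebraMap F E a)
    {x : E} (hx : 0 ≤ w x) : IsIntegral (addValInts (w.comap (algebraMap F E))) x := by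
  have hlift : galoisPoly (⊥ : IntermediateField F E) x ∈
      lifts (algebraMap (addValInts (w.comap (algebraMap F E))) E) := by
    rw [lifts_iff_coeff_lifts]
    intro i
    obtain ⟨c, hc⟩ :=
      IntermediateField.mem_bot.mp (galoisPoly_coeff_mem (⊥ : IntermediateField F E) x i)
    refine ⟨⟨c, ?_⟩, (hA _).trans hc⟩
    rw [mem_addValInts]
    change 0 ≤ w (algebraMap F E c)
    rw [hc]
    exact galoisPoly_coeff_nonneg hinv (⊥ : IntermediateField F E) hx i
  obtain ⟨q, hq, -, hmonic⟩ :=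
    lifts_and_natDegree_eq_and_monic hlift (galoisPoly_monic (⊥ : IntermediateField F E) x)
  refine ⟨q, hmonic, ?_⟩
  rw [← eval_map, hq, galoisPoly_eval_self]

theorem perfectField_residueField {w : AddValuation F (WithTop ℝ)}
    (hperf : ∀ p : ℕ, p.Prime → 0 < w (p : F) →
      ∀ x : F, 0 ≤ w x → ∃ y : F, 0 ≤ w y ∧ 0 < w (x - y ^ p)) :
    PerfectField (IsLocalRing.ResidueField (addValInts w)) := by
  obtain ⟨p, hp⟩ := CharP.exists (IsLocalRing.ResidueField (addValInts w))
  rcases CharP.char_is_prime_or_zero (IsLocalRing.ResidueField (addValInts w)) p with h | rfl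
  · have : Fact p.Prime := ⟨h⟩
    have hpw : 0 < w (p : F) := by
      have h0 : IsLocalRing.residue (addValInts w) (p : addValInts w) = 0 := by
        rw [map_natCast, CharP.cast_eq_zero]
      simpa using mem_maximalIdeal_addValInts.mp ((IsLocalRing.residue_eq_zero_iff _).mp h0)
    have : PerfectRing (IsLocalRing.ResidueField (addValInts w)) p := by
      refine PerfectRing.ofSurjective _ p fun a => ?_
      obtain ⟨x, rfl⟩ := IsLocalRing.residue_surjective a
      obtain ⟨y, hy, hxy⟩ := hperf p h hpw x x.2
      refine ⟨IsLocalRing.residue _ ⟨y, hy⟩, ?_⟩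
      rw [frobenius_def, ← map_pow, eq_comm, ← sub_eq_zero, ← map_sub,
        IsLocalRing.residue_eq_zero_iff, mem_maximalIdeal_addValInts]
      simpa using hxy
    exact PerfectRing.toPerfectField _ p
  · have : CharZero (IsLocalRing.ResidueField (addValInts w)) := CharP.charP_to_charZero _
    infer_instance

open Polynomial in
/-- The ring of integers of a finite Galois extension of discretely valued fields with perfect
residue field is monogenic, provided the valuation is Galois invariant. -/
theorem exists_integer_generator (hinv : ∀ (σ : E ≃ₐ[F] E) x, w (σ x) = w x)
    (hint : ∀ x : F, x ≠ 0 → ∃ n : ℤ, w (algebraMap F E x) = ((n : ℝ) : WithTop ℝ))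
    (hperf : ∀ p : ℕ, p.Prime → 0 < w (algebraMap F E p) →
      ∀ x : F, 0 ≤ w (algebraMap F E x) →
        ∃ y : F, 0 ≤ w (algebraMap F E y) ∧ 0 < w (algebraMap F E (x - y ^ p))) :
    ∃ α : E, 0 ≤ w α ∧ ∀ x : E, 0 ≤ w x →
      ∃ p : F[X], (∀ i, 0 ≤ w (algebraMap F E (p.coeff i))) ∧ aeval α p = x := by
  let wF := w.comap (algebraMap F E)
  let A := addValInts wF
  let B := addValInts w
  let incl : A →+* B := ((algebraMap F E).comp A.subtype).codRestrict B.toSubring fun a => a.2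
  let _ : Algebra A B := incl.toAlgebra
  let _ : Algebra A E := ((algebraMap F E).comp A.subtype).toAlgebra
  have : IsScalarTower A B E := IsScalarTower.of_algebraMap_eq fun _ => rfl
  have : IsScalarTower A F E := IsScalarTower.of_algebraMap_eq fun _ => rfl
  have hcard : Nat.card (E ≃ₐ[F] E) ≠ 0 := Nat.card_pos.ne'
  have : IsPrincipalIdealRing A := isPrincipalIdealRing_addValInts one_ne_zero fun x hx => by
    rw [one_nsmul]
    exact hint x hx
  have : IsPrincipalIdealRing B := isPrincipalIdealRing_addValInts hcard
    (card_nsmul_eq_of_galois_inv hinv hint)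
  have : IsIntegralClosure B A E := by
    refine ⟨Subtype.val_injective, fun {x} => ?_⟩
    refine ⟨fun h => IsIntegrallyClosed.isIntegral_iff.mp (h.tower_top (A := B)), ?_⟩
    rintro ⟨y, rfl⟩
    exact isIntegral_addValInts hinv (fun _ => rfl) y.2
  have : Module.Finite A B := IsIntegralClosure.finite A F E B
  have : IsLocalHom (algebraMap A B) := ⟨fun a ha =>
    (isUnit_addValInts_iff (w := wF)).mpr (isUnit_addValInts_iff (w := w).mp ha)⟩
  have : PerfectField (IsLocalRing.ResidueField A) := perfectField_residueField hperf
  obtain ⟨ϖ, hϖ⟩ : ∃ ϖ, IsLocalRing.maximalIdeal B = Ideal.span {ϖ} :=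
    (IsPrincipalIdealRing.principal (IsLocalRing.maximalIdeal B)).principal
  have hm : ∃ n, IsLocalRing.maximalIdeal B ^ n ≤
      (IsLocalRing.maximalIdeal A).map (algebraMap A B) := by
    by_cases hϖ0 : ϖ = 0
    · refine ⟨1, ?_⟩
      rw [pow_one, hϖ, hϖ0, Ideal.span_singleton_zero]
      exact bot_le
    have hϖE : (ϖ : E) ≠ 0 := by simpa using hϖ0
    have hϖpos : 0 < w ϖ := mem_maximalIdeal_addValInts.mp (hϖ ▸ Ideal.mem_span_singleton_self ϖ)
    have hu : w (algebraMap F E (Algebra.norm F (ϖ : E))) = Nat.card (E ≃ₐ[F] E) • w ϖ :=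
      addVal_norm hinv ϖ
    have hupos : 0 < wF (Algebra.norm F (ϖ : E)) := by
      change 0 < w (algebraMap F E _)
      rw [hu]
      exact nsmul_pos_iff hcard |>.mpr hϖpos
    have huA : (⟨_, hupos.le⟩ : A) ∈ IsLocalRing.maximalIdeal A :=
      mem_maximalIdeal_addValInts.mpr hupos
    have huB : algebraMap A B ⟨_, hupos.le⟩ ≠ 0 := by
      intro h
      have h' : algebraMap F E (Algebra.norm F (ϖ : E)) = 0 := congrArg Subtype.val h
      exact hϖE (by simpa using h')
    refine ⟨Nat.card (E ≃ₐ[F] E), ?_⟩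
    rw [hϖ, Ideal.span_singleton_pow, Ideal.span_singleton_le_iff_mem]
    have hdvd : algebraMap A B ⟨_, hupos.le⟩ ∣ ϖ ^ Nat.card (E ≃ₐ[F] E) := addValInts_dvd huB (by
      change w (algebraMap F E (Algebra.norm F (ϖ : E))) ≤ w ((ϖ : E) ^ _)
      rw [hu, w.map_pow])
    exact Ideal.mem_of_dvd _ hdvd (Ideal.mem_map_of_mem _ huA)
  obtain ⟨n, hn⟩ := hm
  obtain ⟨α, hα⟩ := exists_adjoin_singleton_eq_top (A := A) hϖ hn
  refine ⟨α, α.2, fun x hx => ?_⟩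
  have hmem : (⟨x, hx⟩ : B) ∈ Algebra.adjoin A {α} := hα ▸ trivial
  rw [Algebra.adjoin_singleton_eq_range_aeval] at hmem
  obtain ⟨p, hp⟩ := hmem
  refine ⟨p.map (algebraMap A F), fun i => ?_, ?_⟩
  · rw [coeff_map]
    exact (p.coeff i).2
  · rw [aeval_map_algebraMap]
    have := congrArg (algebraMap B E) hp
    erw [← aeval_algebraMap_apply] at this
    exact this

end Monogenic

theorem exists_le_of_sum_min_le {G : Type*} [Group G] [Fintype G] {d e : G → WithTop ℝ} {J : ℝ}
    (h1 : d 1 = ⊤) (h : ∀ σ τ, min (e σ) (e τ) ≤ d (σ⁻¹ * τ))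
    (hsum : ∑ σ, min (d σ) J ≤ ∑ σ, e σ) : ∃ σ, J ≤ e σ := by
  by_contra! hlt
  have hne (σ : G) : e σ ≠ ⊤ := (hlt σ).ne_top
  have hne' (σ : G) : min (d σ) J ≠ ⊤ := ((min_le_right _ _).trans_lt (WithTop.coe_lt_top J)).ne
  choose e' he' using fun σ => WithTop.ne_top_iff_exists.mp (hne σ)
  choose m hm using fun σ => WithTop.ne_top_iff_exists.mp (hne' σ)
  obtain ⟨ρ, hρ⟩ := Finite.exists_max e'
  simp only [← he', ← hm, ← WithTop.coe_sum, WithTop.coe_le_coe] at hsum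
  rw [← Equiv.sum_comp (Equiv.mulLeft ρ⁻¹) m] at hsum
  refine hsum.not_gt (Finset.sum_lt_sum (fun τ _ => ?_) ⟨ρ, Finset.mem_univ _, ?_⟩)
  · rw [← WithTop.coe_le_coe, he', Equiv.coe_mulLeft, hm]
    refine le_min ?_ (hlt τ).le
    have := h ρ τ
    rwa [← he', ← he', min_eq_right (WithTop.coe_le_coe.mpr (hρ τ)), he'] at this
  · rw [← WithTop.coe_lt_coe, he', Equiv.coe_mulLeft, hm]
    simp only [inv_mul_cancel, h1]
    exact lt_min (hlt ρ).ne_top.lt_top (hlt ρ)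

theorem sum_min_le_of_le {G : Type*} [Group G] [Fintype G] {d e : G → WithTop ℝ} {J : ℝ}
    (h : ∀ σ τ, min (d (σ⁻¹ * τ)) (e σ) ≤ e τ) {ρ : G} (hρ : J ≤ e ρ) :
    ∑ σ, min (d σ) J ≤ ∑ σ, e σ := by
  rw [← Equiv.sum_comp (Equiv.mulLeft ρ⁻¹)]
  exact Finset.sum_le_sum fun τ _ => (min_le_min_left _ hρ).trans (h ρ τ)

theorem mem_of_forall_algEquiv_eq {F Ω : Type*} [Field F] [Field Ω] [Algebra F Ω] [IsAlgClosed Ω]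
    [Algebra.IsAlgebraic F Ω] {x : Ω} (hx : IsSeparable F x) (h : ∀ τ : Ω ≃ₐ[F] Ω, τ x = x) :
    x ∈ (algebraMap F Ω).range := by
  have : IsAlgClosure F Ω := ⟨inferInstance, inferInstance⟩
  have : Normal F Ω := IsAlgClosure.normal F Ω
  have hint : IsIntegral F x := hx.isIntegral
  rw [← minpoly.natDegree_eq_one_iff, ← Polynomial.card_rootSet_eq_natDegree hx
    (IsAlgClosed.splits ((minpoly F x).map (algebraMap F Ω))), Fintype.card_eq_one_iff]
  refine ⟨⟨x, ?_⟩, ?_⟩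
  · rw [Polynomial.mem_rootSet]
    exact ⟨minpoly.ne_zero hint, minpoly.aeval F x⟩
  · rintro ⟨y, hy⟩
    obtain ⟨τ, hτ⟩ := minpoly.exists_algEquiv_of_root' (Algebra.IsAlgebraic.isAlgebraic x)
      (Polynomial.mem_rootSet.mp hy).2
    exact Subtype.ext (hτ.symm.trans (h τ))

theorem addVal_prod {F : Type*} [Field F] (w : AddValuation F (WithTop ℝ)) {ι : Type*}
    (s : Finset ι) (f : ι → F) : w (∏ i ∈ s, f i) = ∑ i ∈ s, w (f i) := by
  induction s using Finset.induction_on with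
  | empty => simp
  | insert i s hi ih => rw [Finset.prod_insert hi, Finset.sum_insert hi, w.map_mul, ih]

namespace Fontaine

section

variable {K Ω : Type} [Field K] [Field Ω] [Algebra K Ω] {v : Ω → ℝ}

theorem IsCDV.map_one (hv : IsCDV K Ω v) : v 1 = 0 := by
  have := hv.map_mul 1 1 one_ne_zero one_ne_zero
  rw [mul_one] at this
  linarith

/-- The valuation of `Ω`, with the value `⊤` at `0`. -/
def IsCDV.addVal (hv : IsCDV K Ω v) : AddValuation Ω (WithTop ℝ) :=
  AddValuation.of (fun x => if x = 0 then ⊤ else (v x : WithTop ℝ)) (by simp)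
    (by simp [hv.map_one])
    (fun x y => by
      by_cases hx : x = 0
      · simp [hx]
      by_cases hy : y = 0
      · simp [hy]
      by_cases hxy : x + y = 0
      · simp [hxy]
      simp only [hx, hy, hxy, if_false]
      exact_mod_cast hv.add_ge x y hx hy hxy)
    (fun x y => by
      by_cases hx : x = 0
      · simp [hx]
      by_cases hy : y = 0
      · simp [hy]
      simp only [hx, hy, mul_eq_zero, or_self, if_false]
      exact_mod_cast hv.map_mul x y hx hy)

theorem IsCDV.addVal_apply (hv : IsCDV K Ω v) {x : Ω} (hx : x ≠ 0) :
    hv.addVal x = (v x : WithTop ℝ) := by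
  simp [addVal, hx]

theorem IsCDV.le_addVal (hv : IsCDV K Ω v) {x : Ω} {r : ℝ} :
    (r : WithTop ℝ) ≤ hv.addVal x ↔ x = 0 ∨ r ≤ v x := by
  by_cases hx : x = 0
  · simp [hx]
  · simp [hv.addVal_apply hx, hx]

theorem IsCDV.lt_addVal (hv : IsCDV K Ω v) {x : Ω} {r : ℝ} :
    (r : WithTop ℝ) < hv.addVal x ↔ x = 0 ∨ r < v x := by
  by_cases hx : x = 0
  · simp [hx]
  · simp [hv.addVal_apply hx, hx]

theorem IsCDV.isInt_iff (hv : IsCDV K Ω v) {E : IntermediateField K Ω} {x : Ω} :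
    IsInt v E x ↔ x ∈ E ∧ 0 ≤ hv.addVal x := by
  rw [IsInt, ← WithTop.coe_zero, hv.le_addVal]

theorem IsCDV.addVal_algEquiv (hv : IsCDV K Ω v) {L : IntermediateField K Ω} (σ : L ≃ₐ[K] L)
    (x : L) : hv.addVal (σ x : Ω) = hv.addVal (x : Ω) := by
  by_cases hx : x = 0
  · simp [hx]
  · rw [hv.addVal_apply (by simpa using hx), hv.addVal_apply (by simpa using hx), hv.galois_inv]

theorem IsCDV.addVal_algEquiv_top (hv : IsCDV K Ω v) (τ : Ω ≃ₐ[K] Ω) (x : Ω) :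
    hv.addVal (τ x) = hv.addVal x :=
  hv.addVal_algEquiv ((IntermediateField.topEquiv.trans τ).trans IntermediateField.topEquiv.symm)
    (⟨x, trivial⟩ : (⊤ : IntermediateField K Ω))

/-- The restriction of the valuation to `L`. -/
def IsCDV.resVal (hv : IsCDV K Ω v) (L : IntermediateField K Ω) : AddValuation L (WithTop ℝ) :=
  hv.addVal.comap (algebraMap L Ω)

theorem IsCDV.resVal_apply (hv : IsCDV K Ω v) (L : IntermediateField K Ω) (x : L) :
    hv.resVal L x = hv.addVal (x : Ω) := rfl

theorem IsCDV.resVal_algebraMap (hv : IsCDV K Ω v) (L : IntermediateField K Ω) (x : K) :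
    hv.resVal L (algebraMap K L x) = hv.addVal (algebraMap K Ω x) := rfl

theorem IsCDV.addVal_algebraMap_int (hv : IsCDV K Ω v) (x : K) (hx : x ≠ 0) :
    ∃ n : ℤ, hv.addVal (algebraMap K Ω x) = ((n : ℝ) : WithTop ℝ) := by
  obtain ⟨n, hn⟩ := hv.int_valued x hx
  exact ⟨n, by rw [hv.addVal_apply (by simpa using hx), hn]⟩

variable {L : IntermediateField K Ω}

/-- `α` generates the ring of integers of `L` over that of `K`. -/
def IsCDV.IsGenerator (hv : IsCDV K Ω v) (α : L) : Prop :=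
  0 ≤ hv.addVal (α : Ω) ∧ ∀ x : L, 0 ≤ hv.addVal (x : Ω) →
    ∃ p : Polynomial K, (∀ i, 0 ≤ hv.addVal (algebraMap K Ω (p.coeff i))) ∧
      Polynomial.aeval α p = x

theorem IsCDV.IsGenerator.nonneg {hv : IsCDV K Ω v} {α : L} (hα : hv.IsGenerator α) :
    0 ≤ hv.addVal (α : Ω) := hα.1

theorem mem_relGal {F : IntermediateField K Ω} {σ : L ≃ₐ[K] L} :
    σ ∈ relGal F L ↔ σ ∈ (F.comap L.val).fixingSubgroup := by
  rw [IntermediateField.mem_fixingSubgroup_iff]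
  rfl

/-- The integers of `L` lying in `F`. -/
def IsCDV.relInts (hv : IsCDV K Ω v) (L F : IntermediateField K Ω) : Subring L :=
  (addValInts (hv.resVal L)).toSubring ⊓ (F.comap L.val).toSubfield.toSubring

/-- The inclusion of the integers of `F` into those of `Ω`. -/
def IsCDV.relIncl (hv : IsCDV K Ω v) (L F : IntermediateField K Ω) :
    hv.relInts L F →+* addValInts hv.addVal :=
  ((algebraMap L Ω).comp (hv.relInts L F).subtype).codRestrict (addValInts hv.addVal).toSubring
    fun a => a.2.1

/-- Evaluation of integral polynomials over `F` at integers of `Ω`. -/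
def IsCDV.relEval (hv : IsCDV K Ω v) (L F : IntermediateField K Ω) (β : addValInts hv.addVal) :
    Polynomial (hv.relInts L F) →+* addValInts hv.addVal :=
  Polynomial.eval₂RingHom (hv.relIncl L F) β

/-- The conjugates of an integer `α` of `L`, as integers of `Ω`. -/
def IsCDV.conj (hv : IsCDV K Ω v) {α : L} (hα : 0 ≤ hv.addVal (α : Ω)) (σ : L ≃ₐ[K] L) :
    addValInts hv.addVal :=
  ⟨σ α, hα.trans_eq (hv.addVal_algEquiv σ α).symm⟩

theorem IsCDV.relEval_mem (hv : IsCDV K Ω v) {F E : IntermediateField K Ω} (hFE : F ≤ E)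
    {β : addValInts hv.addVal} (hβ : (β : Ω) ∈ E) (p : Polynomial (hv.relInts L F)) :
    (hv.relEval L F β p : Ω) ∈ E := by
  have : (hv.relEval L F β p : Ω) = p.sum fun i a => ((a : L) : Ω) * (β : Ω) ^ i := by
    change (addValInts hv.addVal).subtype (p.eval₂ (hv.relIncl L F) β) = _
    rw [Polynomial.hom_eval₂, Polynomial.eval₂_eq_sum]
    rfl
  rw [this]
  exact sum_mem fun i _ => mul_mem (hFE (p.coeff i).2.2) (pow_mem hβ i)

theorem IsCDV.relEval_conj (hv : IsCDV K Ω v) {F : IntermediateField K Ω} {α : L}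
    (hα : 0 ≤ hv.addVal (α : Ω)) {σ : L ≃ₐ[K] L} (hσ : σ ∈ (F.comap L.val).fixingSubgroup)
    (p : Polynomial (hv.relInts L F)) :
    (hv.relEval L F (hv.conj hα σ) p : Ω) = (σ (p.eval₂ (hv.relInts L F).subtype α) : L) := by
  change (addValInts hv.addVal).subtype (p.eval₂ (hv.relIncl L F) _) =
    algebraMap L Ω ((σ : L →+* L) (p.eval₂ _ α))
  rw [Polynomial.hom_eval₂, Polynomial.hom_eval₂, Polynomial.hom_eval₂]
  refine congrArg₂ (fun f x => p.eval₂ f x) (RingHom.ext fun c => ?_) rfl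
  exact congrArg (algebraMap L Ω)
    (((IntermediateField.mem_fixingSubgroup_iff _ σ).mp hσ c c.2.2).symm)

theorem IsCDV.IsGenerator.exists_relInts (hv : IsCDV K Ω v) {α : L} (hα : hv.IsGenerator α)
    (F : IntermediateField K Ω) {x : L} (hx : 0 ≤ hv.addVal (x : Ω)) :
    ∃ p : Polynomial (hv.relInts L F), p.eval₂ (hv.relInts L F).subtype α = x := by
  obtain ⟨p, hp, hpx⟩ := hα.2 x hx
  have hl : p.map (algebraMap K L) ∈ Polynomial.lifts (hv.relInts L F).subtype := by
    rw [Polynomial.lifts_iff_coeff_lifts]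
    intro i
    rw [Polynomial.coeff_map]
    exact ⟨⟨_, hp i, F.algebraMap_mem _⟩, rfl⟩
  obtain ⟨q, hq⟩ := (Polynomial.mem_lifts _).mp hl
  exact ⟨q, by rw [← Polynomial.eval_map, hq, Polynomial.eval_map_algebraMap, hpx]⟩

theorem IsCDV.IsGenerator.algEquiv (hv : IsCDV K Ω v) {α : L} (hα : hv.IsGenerator α)
    (σ : L ≃ₐ[K] L) : hv.IsGenerator (σ α) := by
  refine ⟨hα.nonneg.trans_eq (hv.addVal_algEquiv σ α).symm, fun x hx => ?_⟩
  obtain ⟨p, hp, hpx⟩ := hα.2 (σ.symm x) (hx.trans_eq (hv.addVal_algEquiv σ.symm x).symm)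
  refine ⟨p, hp, ?_⟩
  rw [Polynomial.aeval_algEquiv]
  simp [hpx]

theorem IsCDV.IsGenerator.le_sub (hv : IsCDV K Ω v) {α : L} (hα : hv.IsGenerator α)
    (σ : L ≃ₐ[K] L) {x : L} (hx : 0 ≤ hv.addVal (x : Ω)) :
    hv.addVal ((σ α : Ω) - α) ≤ hv.addVal ((σ x : Ω) - x) := by
  obtain ⟨p, rfl⟩ := hα.exists_relInts hv ⊥ hx
  have hfix (τ : L ≃ₐ[K] L) : τ ∈ ((⊥ : IntermediateField K Ω).comap L.val).fixingSubgroup := by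
    rw [IntermediateField.mem_fixingSubgroup_iff]
    rintro x hx
    obtain ⟨c, hc⟩ := IntermediateField.mem_bot.mp hx
    have : x = algebraMap K L c := Subtype.ext hc.symm
    rw [this, τ.commutes]
  obtain ⟨c, hc⟩ := Polynomial.sub_dvd_eval_sub (hv.conj hα.nonneg σ) (hv.conj hα.nonneg 1)
    (p.map (hv.relIncl L ⊥))
  rw [Polynomial.eval_map, Polynomial.eval_map] at hc
  have hc' := congrArg (fun z : addValInts hv.addVal => (z : Ω)) hc
  have h1 := hv.relEval_conj hα.nonneg (hfix σ) p
  have h2 := hv.relEval_conj hα.nonneg (hfix 1) p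
  change (hv.relEval L ⊥ (hv.conj hα.nonneg σ) p : Ω) -
    (hv.relEval L ⊥ (hv.conj hα.nonneg 1) p : Ω) =
    ((σ α : Ω) - α) * c at hc'
  rw [h1, h2] at hc'
  change _ ≤ hv.addVal (_ - ((1 : L ≃ₐ[K] L) (p.eval₂ _ α) : Ω))
  rw [hc', hv.addVal.map_mul]
  exact le_add_of_nonneg_right c.2

theorem IsCDV.IsGenerator.eq_one (hv : IsCDV K Ω v) {α : L} (hα : hv.IsGenerator α)
    {σ : L ≃ₐ[K] L} (hσ : σ α = α) : σ = 1 := by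
  have h (x : L) (hx : 0 ≤ hv.addVal (x : Ω)) : σ x = x := by
    have := hα.le_sub hv σ hx
    rw [hσ, sub_self, hv.addVal.map_zero, top_le_iff, hv.addVal.top_iff, sub_eq_zero] at this
    exact Subtype.ext this
  ext x
  refine congrArg _ ?_
  rcases (addValInts (hv.resVal L)).mem_or_inv_mem' x with hx | hx
  · exact h x hx
  · have := h x⁻¹ hx
    rw [map_inv₀] at this
    exact inv_injective this

theorem IsCDV.conj_injective (hv : IsCDV K Ω v) {α : L} (hα : hv.IsGenerator α) :
    Function.Injective (hv.conj hα.nonneg) := by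
  intro σ τ h
  have h' : σ α = τ α := Subtype.ext (congrArg (fun z : addValInts hv.addVal => (z : Ω)) h)
  have : τ⁻¹ * σ = 1 := hα.eq_one hv (by
    rw [AlgEquiv.mul_apply, h', ← AlgEquiv.mul_apply, inv_mul_cancel, AlgEquiv.one_apply])
  exact (inv_mul_eq_one.mp this).symm

theorem IsCDV.IsGenerator.addVal_sub (hv : IsCDV K Ω v) {α : L} (hα : hv.IsGenerator α)
    {σ : L ≃ₐ[K] L} (hσ : σ ≠ 1) :
    hv.addVal ((σ α : Ω) - α) = (v ((σ α : Ω) - α) : WithTop ℝ) := by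
  refine hv.addVal_apply fun h => hσ (hα.eq_one hv ?_)
  exact Subtype.ext (sub_eq_zero.mp h)

theorem mem_relGal_bot (σ : L ≃ₐ[K] L) : σ ∈ relGal ⊥ L := by
  intro x hx
  obtain ⟨c, hc⟩ := IntermediateField.mem_bot.mp hx
  have : x = algebraMap K L c := Subtype.ext hc.symm
  rw [this, σ.commutes]

theorem ramFixed_le : ramFixed v L ≤ L := fun _ ⟨hx, _⟩ => hx

theorem IsCDV.addVal_inv_mul_sub (hv : IsCDV K Ω v) (σ τ : L ≃ₐ[K] L) (x : L) :
    hv.addVal (((σ⁻¹ * τ) x : Ω) - x) = hv.addVal ((τ x : Ω) - σ x) := by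
  have h : σ ((σ⁻¹ * τ) x - x) = τ x - σ x := by
    rw [map_sub, ← AlgEquiv.mul_apply, mul_inv_cancel_left]
  exact (hv.addVal_algEquiv σ ((σ⁻¹ * τ) x - x)).symm.trans
    (congrArg (fun z : L => hv.addVal (z : Ω)) h)

/-- The ideal of integers of `Ω` of valuation at least `T`. -/
def IsCDV.valIdeal (hv : IsCDV K Ω v) (T : ℝ) : Ideal (addValInts hv.addVal) where
  carrier := {x | T ≤ hv.addVal x}
  zero_mem' := by simp
  add_mem' hx hy := hv.addVal.map_le_add hx hy
  smul_mem' c x hx := by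
    change _ ≤ hv.addVal (c * x : Ω)
    rw [hv.addVal.map_mul]
    exact le_trans hx (le_add_of_nonneg_left c.2)

theorem IsCDV.mem_valIdeal (hv : IsCDV K Ω v) {T : ℝ} {x : addValInts hv.addVal} :
    x ∈ hv.valIdeal T ↔ T ≤ hv.addVal x := Iff.rfl

variable [FiniteDimensional K L]

theorem IsCDV.IsGenerator.sum_le (hv : IsCDV K Ω v) {α : L} (hα : hv.IsGenerator α)
    {F : IntermediateField K Ω} {p : Polynomial (hv.relInts L F)}
    (hp : p.eval₂ (hv.relInts L F).subtype α = 0) (β : addValInts hv.addVal) :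
    ∑ σ : (F.comap L.val).fixingSubgroup, hv.addVal ((β : Ω) - ((σ : L ≃ₐ[K] L) α : L)) ≤
      hv.addVal (hv.relEval L F β p) := by
  have hev (x : addValInts hv.addVal) :
      hv.relEval L F x p = (p.map (hv.relIncl L F)).eval x := (Polynomial.eval_map _ _).symm
  have hdvd : ∏ σ : (F.comap L.val).fixingSubgroup,
      (Polynomial.X - Polynomial.C (hv.conj hα.nonneg σ)) ∣ p.map (hv.relIncl L F) := by
    by_cases hq : p.map (hv.relIncl L F) = 0
    · exact hq ▸ dvd_zero _
    have : (∏ σ : (F.comap L.val).fixingSubgroup,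
        (Polynomial.X - Polynomial.C (hv.conj hα.nonneg σ))) =
        (((Finset.univ.val.map fun σ : (F.comap L.val).fixingSubgroup =>
          hv.conj hα.nonneg σ)).map fun a => Polynomial.X - Polynomial.C a).prod := by
      rw [Multiset.map_map]
      rfl
    rw [this, Multiset.prod_X_sub_C_dvd_iff_le_roots hq, Multiset.le_iff_subset]
    swap
    · exact Finset.univ.nodup.map ((hv.conj_injective hα).comp Subtype.val_injective)
    intro x hx
    obtain ⟨σ, -, rfl⟩ := Multiset.mem_map.mp hx
    rw [Polynomial.mem_roots hq, Polynomial.IsRoot, ← hev]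
    refine Subtype.ext ?_
    rw [hv.relEval_conj hα.nonneg σ.2, hp, map_zero]
    rfl
  obtain ⟨c, hc⟩ := Polynomial.eval_dvd (x := β) hdvd
  rw [hev, hc, Polynomial.eval_prod]
  change _ ≤ hv.addVal ((addValInts hv.addVal).subtype _ * (c : Ω))
  rw [hv.addVal.map_mul, map_prod, addVal_prod]
  simp only [Polynomial.eval_sub, Polynomial.eval_X, Polynomial.eval_C, map_sub]
  exact le_add_of_nonneg_right c.2

variable [IsGalois K L]

theorem IsCDV.exists_pos_le (hv : IsCDV K Ω v) :
    ∃ ε > 0, ∀ x ∈ L, x ≠ 0 → 0 < v x → ε ≤ v x := by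
  have hcard : 0 < Nat.card (L ≃ₐ[K] L) := Nat.card_pos
  refine ⟨(Nat.card (L ≃ₐ[K] L) : ℝ)⁻¹, by positivity, fun x hx hx0 hpos => ?_⟩
  obtain ⟨n, hn⟩ := card_nsmul_eq_of_galois_inv (w := hv.resVal L) hv.addVal_algEquiv
    hv.addVal_algebraMap_int ⟨x, hx⟩ (fun h => hx0 (congrArg Subtype.val h))
  rw [hv.resVal_apply, hv.addVal_apply hx0] at hn
  norm_cast at hn
  rw [nsmul_eq_mul] at hn
  have hn0 : 0 < n := by
    have : (0 : ℝ) < n := hn ▸ by positivity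
    exact_mod_cast this
  have : (1 : ℝ) ≤ n := by exact_mod_cast hn0
  rw [inv_le_iff_one_le_mul₀' (by positivity), hn]
  exact this

theorem IsCDV.ramIdx_pos (hv : IsCDV K Ω v) {F : IntermediateField K Ω} (hF : F ≤ L) :
    0 < ramIdx v F := by
  obtain ⟨ε, hε, hεle⟩ := hv.exists_pos_le (L := L)
  obtain ⟨u, hu⟩ := hv.exists_uniformizer
  have hne : {r : ℝ | 0 < r ∧ ∃ x ∈ F, v x = r}.Nonempty :=
    ⟨1, one_pos, algebraMap K Ω u, F.algebraMap_mem u, hu⟩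
  rw [ramIdx, inv_pos, minVal]
  by_cases h0 : 0 < v 0
  · refine lt_of_lt_of_le (lt_min hε h0) (le_csInf hne ?_)
    rintro r ⟨hr, x, hx, rfl⟩
    by_cases hx0 : x = 0
    · exact hx0 ▸ min_le_right _ _
    · exact (min_le_left _ _).trans (hεle x (hF hx) hx0 hr)
  · refine lt_of_lt_of_le hε (le_csInf hne ?_)
    rintro r ⟨hr, x, hx, rfl⟩
    exact hεle x (hF hx) (fun h => h0 (h ▸ hr)) hr

theorem IsCDV.inId_iff (hv : IsCDV K Ω v) {F : IntermediateField K Ω} (hF : F ≤ L) {r : ℝ}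
    {x : Ω} : InId v F (ramIdx v F * r) x ↔ (r : WithTop ℝ) ≤ hv.addVal x := by
  rw [InId, hv.le_addVal, vRel, mul_comm, mul_le_mul_iff_left₀ (hv.ramIdx_pos hF)]

theorem IsCDV.exists_isGenerator (hv : IsCDV K Ω v) (hperf : PerfectResidue v K) :
    ∃ α : L, hv.IsGenerator α := by
  refine exists_integer_generator (w := hv.resVal L) hv.addVal_algEquiv hv.addVal_algebraMap_int
    ?_
  intro p hp hpv x hx
  have hnonneg (z : K) : 0 ≤ hv.resVal L (algebraMap K L z) ↔ IsIntK v K z := by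
    rw [hv.resVal_algebraMap, ← WithTop.coe_zero, hv.le_addVal, IsIntK, map_eq_zero]
  have hpos (z : K) : 0 < hv.resVal L (algebraMap K L z) ↔
      z = 0 ∨ 0 < v (algebraMap K Ω z) := by
    rw [hv.resVal_algebraMap, ← WithTop.coe_zero, hv.lt_addVal, map_eq_zero]
  obtain ⟨y, hy, hxy⟩ := hperf p hp ((hpos _).mp hpv) x ((hnonneg x).mp hx)
  exact ⟨y, (hnonneg y).mpr hy, (hpos _).mpr hxy⟩

theorem IsCDV.lowerAt_iff (hv : IsCDV K Ω v) {α : L} (hα : hv.IsGenerator α)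
    {F : IntermediateField K Ω} (hF : F ≤ L) {σ : L ≃ₐ[K] L} {r : ℝ} :
    lowerAt v F L σ (ramIdx v F * r) ↔
      σ ∈ relGal F L ∧ (r : WithTop ℝ) ≤ hv.addVal ((σ α : Ω) - α) := by
  have key (x : L) : (σ x = x ∨ ramIdx v F * r ≤ vRel v F ((σ x : Ω) - x)) ↔
      (r : WithTop ℝ) ≤ hv.addVal ((σ x : Ω) - x) := by
    rw [← hv.inId_iff hF, InId, sub_eq_zero, Subtype.coe_inj]
  rw [lowerAt]
  simp only [key, hv.isInt_iff]
  exact and_congr_right fun _ => ⟨fun h => h α ⟨α.2, hα.nonneg⟩,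
    fun h x hx => h.trans (hα.le_sub hv σ hx.2)⟩

theorem IsCDV.lowerAt_iff_le (hv : IsCDV K Ω v) {α : L} (hα : hv.IsGenerator α)
    {F : IntermediateField K Ω} (hF : F ≤ L) {σ : L ≃ₐ[K] L} (hσ1 : σ ≠ 1) {i : ℝ} :
    lowerAt v F L σ i ↔ σ ∈ relGal F L ∧ i ≤ ramIdx v F * v ((σ α : Ω) - α) := by
  have hc := hv.ramIdx_pos hF
  conv_lhs => rw [← mul_div_cancel₀ i hc.ne', hv.lowerAt_iff hα hF, hα.addVal_sub hv hσ1,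
    WithTop.coe_le_coe, div_le_iff₀' hc]

theorem IsCDV.iFon_eq (hv : IsCDV K Ω v) {α : L} (hα : hv.IsGenerator α)
    {F : IntermediateField K Ω} (hF : F ≤ L) {σ : L ≃ₐ[K] L} (hσ : σ ∈ relGal F L)
    (hσ1 : σ ≠ 1) : iFon v F L σ = ramIdx v F * v ((σ α : Ω) - α) := by
  simp only [iFon, hv.lowerAt_iff_le hα hF hσ1, hσ, true_and]
  exact csSup_Iic

theorem IsCDV.iBreak_eq (hv : IsCDV K Ω v) {α : L} (hα : hv.IsGenerator α)
    {F : IntermediateField K Ω} (hF : F ≤ L) {σ : L ≃ₐ[K] L} (hσ : σ ∈ relGal F L)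
    (hσ1 : σ ≠ 1) (hmax : ∀ τ : L ≃ₐ[K] L, τ ≠ 1 → v ((τ α : Ω) - α) ≤ v ((σ α : Ω) - α)) :
    iBreak v F L = ramIdx v F * v ((σ α : Ω) - α) := by
  have : {i : ℝ | ∃ σ : L ≃ₐ[K] L, σ ≠ 1 ∧ lowerAt v F L σ i} =
      Set.Iic (ramIdx v F * v ((σ α : Ω) - α)) := by
    ext i
    refine ⟨?_, fun hi => ⟨σ, hσ1, (hv.lowerAt_iff_le hα hF hσ1).mpr ⟨hσ, hi⟩⟩⟩
    rintro ⟨τ, hτ1, hτ⟩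
    exact ((hv.lowerAt_iff_le hα hF hτ1).mp hτ).2.trans
      (mul_le_mul_of_nonneg_left (hmax τ hτ1) (hv.ramIdx_pos hF).le)
  rw [iBreak, this, csSup_Iic]

theorem IsCDV.exists_iBreak_eq (hv : IsCDV K Ω v) {α : L} (hα : hv.IsGenerator α) :
    ∃ J : ℝ, iBreak v ⊥ L = ramIdx v (⊥ : IntermediateField K Ω) * J ∧
      iBreak v (ramFixed v L) L = ramIdx v (ramFixed v L) * J := by
  by_cases htriv : ∀ σ : L ≃ₐ[K] L, σ = 1
  · have (F : IntermediateField K Ω) : iBreak v F L = 0 := by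
      have : {i : ℝ | ∃ σ : L ≃ₐ[K] L, σ ≠ 1 ∧ lowerAt v F L σ i} = ∅ :=
        Set.eq_empty_of_forall_notMem fun i ⟨σ, hσ, _⟩ => hσ (htriv σ)
      rw [iBreak, this, Real.sSup_empty]
    exact ⟨0, by simp [this], by simp [this]⟩
  · push Not at htriv
    obtain ⟨τ, hτ⟩ := htriv
    have : Nonempty {σ : L ≃ₐ[K] L // σ ≠ 1} := ⟨⟨τ, hτ⟩⟩
    obtain ⟨⟨σ, hσ1⟩, hmax⟩ := Finite.exists_max
      fun σ : {σ : L ≃ₐ[K] L // σ ≠ 1} => v ((σ.1 α : Ω) - α)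
    have hmax' (τ : L ≃ₐ[K] L) (hτ : τ ≠ 1) := hmax ⟨τ, hτ⟩
    have hbot := hv.iBreak_eq hα bot_le (mem_relGal_bot σ) hσ1 hmax'
    refine ⟨_, hbot, hv.iBreak_eq hα ramFixed_le ?_ hσ1 hmax'⟩
    rintro x ⟨hx, hfix⟩
    exact hfix σ ((hv.lowerAt_iff_le hα bot_le hσ1).mpr ⟨mem_relGal_bot σ, hbot.le⟩)

theorem IsCDV.phiT_eq (hv : IsCDV K Ω v) {α : L} (hα : hv.IsGenerator α)
    {F : IntermediateField K Ω} (hF : F ≤ L) (J : ℝ) :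
    ∃ T : ℝ, phiT v F L (ramIdx v F * J) = ramIdx v F * T ∧
      (T : WithTop ℝ) = ∑ σ : (F.comap L.val).fixingSubgroup,
        min (hv.addVal (((σ : L ≃ₐ[K] L) α : Ω) - α)) (J : WithTop ℝ) := by
  let s := (Finset.univ : Finset (F.comap L.val).fixingSubgroup).erase 1
  have hs : ∀ σ ∈ s, (σ : L ≃ₐ[K] L) ≠ 1 := fun σ hσ h =>
    Finset.ne_of_mem_erase hσ (Subtype.ext h)
  refine ⟨J + ∑ σ ∈ s, min (v (((σ : L ≃ₐ[K] L) α : Ω) - α)) J, ?_, ?_⟩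
  · rw [phiT, mul_add, Finset.mul_sum]
    congr 1
    have hset : {σ : L ≃ₐ[K] L | σ ∈ relGal F L ∧ σ ≠ 1} =
        ((s.map (Function.Embedding.subtype _) : Finset (L ≃ₐ[K] L)) : Set (L ≃ₐ[K] L)) := by
      ext σ
      simp [s, mem_relGal, and_comm]
    rw [hset, finsum_mem_coe_finset, Finset.sum_map]
    refine Finset.sum_congr rfl fun σ hσ => ?_
    rw [Function.Embedding.subtype_apply, hv.iFon_eq hα hF (mem_relGal.mpr σ.2) (hs σ hσ),
      mul_min_of_nonneg _ _ (hv.ramIdx_pos hF).le]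
  · rw [← Finset.add_sum_erase _ _ (Finset.mem_univ 1), WithTop.coe_add, WithTop.coe_sum]
    congr 1
    · simp
    · refine Finset.sum_congr rfl fun σ hσ => ?_
      rw [hα.addVal_sub hv (hs σ hσ), WithTop.coe_min]

theorem IsCDV.isHomMod_iff (hv : IsCDV K Ω v) {F E : IntermediateField K Ω} (hF : F ≤ L) {T : ℝ}
    {f : Ω → Ω} : IsHomMod v F L E (ramIdx v F * T) f ↔
      (∀ x, x ∈ L ∧ 0 ≤ hv.addVal x → f x ∈ E ∧ 0 ≤ hv.addVal (f x)) ∧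
      (∀ x y, x ∈ L ∧ 0 ≤ hv.addVal x → y ∈ L ∧ 0 ≤ hv.addVal y →
        T ≤ hv.addVal (f (x + y) - (f x + f y))) ∧
      (∀ x y, x ∈ L ∧ 0 ≤ hv.addVal x → y ∈ L ∧ 0 ≤ hv.addVal y →
        T ≤ hv.addVal (f (x * y) - f x * f y)) ∧
      T ≤ hv.addVal (f 1 - 1) ∧
      (∀ c, c ∈ F ∧ 0 ≤ hv.addVal c → T ≤ hv.addVal (f c - c)) := by
  simp only [IsHomMod, hv.isInt_iff, hv.inId_iff hF]

theorem IsCDV.exists_le_of_homMod (hv : IsCDV K Ω v) {α : L} (hα : hv.IsGenerator α)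
    {F E : IntermediateField K Ω} (hF : F ≤ L) {J : ℝ}
    (h : HomMod v F L E (phiT v F L (ramIdx v F * J))) :
    ∃ σ ∈ (F.comap L.val).fixingSubgroup, ∃ β ∈ E, 0 ≤ hv.addVal β ∧
      J ≤ hv.addVal (β - (σ α : L)) := by
  obtain ⟨f, hf⟩ := h
  obtain ⟨T, hT, hsum⟩ := hv.phiT_eq hα hF J
  rw [hT, hv.isHomMod_iff hF] at hf
  obtain ⟨hint, hadd, hmul, hone, hfix⟩ := hf
  have hL (x : addValInts (hv.resVal L)) : ((x : L) : Ω) ∈ L ∧ 0 ≤ hv.addVal ((x : L) : Ω) :=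
    ⟨x.1.2, x.2⟩
  let f' (x : addValInts (hv.resVal L)) : addValInts hv.addVal := ⟨f x, (hint _ (hL x)).2⟩
  let φ : addValInts (hv.resVal L) →+* addValInts hv.addVal ⧸ hv.valIdeal T :=
    RingHom.mk' ⟨⟨fun x => Ideal.Quotient.mk _ (f' x),
      Ideal.Quotient.eq.mpr (hv.mem_valIdeal.mpr hone)⟩,
      fun x y => Ideal.Quotient.eq.mpr (hv.mem_valIdeal.mpr (hmul _ _ (hL x) (hL y)))⟩
      fun x y => Ideal.Quotient.eq.mpr (hv.mem_valIdeal.mpr (hadd _ _ (hL x) (hL y)))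
  let ι : hv.relInts L F →+* addValInts (hv.resVal L) := Subring.inclusion inf_le_left
  let α' : addValInts (hv.resVal L) := ⟨α, hα.nonneg⟩
  obtain ⟨g, hg⟩ : ∃ g : Polynomial (hv.relInts L F),
      g.map (hv.relInts L F).subtype = galoisPoly (F.comap L.val) α := by
    rw [← Polynomial.mem_lifts, Polynomial.lifts_iff_coeff_lifts]
    exact fun i => ⟨⟨_, galoisPoly_coeff_nonneg (w := hv.resVal L) hv.addVal_algEquiv _
      hα.nonneg i, galoisPoly_coeff_mem _ _ i⟩, rfl⟩
  have hroot : g.eval₂ ι α' = 0 := by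
    refine Subtype.val_injective ?_
    change (addValInts (hv.resVal L)).subtype (g.eval₂ ι α') = 0
    rw [Polynomial.hom_eval₂]
    change g.eval₂ (hv.relInts L F).subtype α = 0
    rw [← Polynomial.eval_map, hg, galoisPoly_eval_self]
  have hmem : hv.relEval L F (f' α') g ∈ hv.valIdeal T := by
    rw [← Ideal.Quotient.eq_zero_iff_mem]
    change Ideal.Quotient.mk _ (g.eval₂ (hv.relIncl L F) (f' α')) = 0
    rw [Polynomial.hom_eval₂, ← map_zero φ, ← hroot, Polynomial.hom_eval₂]
    refine congrArg₂ (fun h x => g.eval₂ h x) (RingHom.ext fun c => ?_) rfl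
    exact (Ideal.Quotient.eq.mpr (hv.mem_valIdeal.mpr (hfix _ ⟨c.2.2, c.2.1⟩))).symm
  have hval : (hv.relEval L F (f' α') g : Ω) =
      ∏ σ : (F.comap L.val).fixingSubgroup, (f α - ((σ : L ≃ₐ[K] L) α : L)) := by
    change (addValInts hv.addVal).subtype (g.eval₂ (hv.relIncl L F) (f' α')) = _
    rw [Polynomial.hom_eval₂]
    change g.eval₂ ((algebraMap L Ω).comp (hv.relInts L F).subtype) (f α) = _
    rw [← Polynomial.eval₂_map, hg, galoisPoly, Polynomial.eval₂_finsetProd]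
    simp only [Polynomial.eval₂_sub, Polynomial.eval₂_X, Polynomial.eval₂_C]
    rfl
  have hle : (T : WithTop ℝ) ≤ ∑ σ : (F.comap L.val).fixingSubgroup,
      hv.addVal (f α - ((σ : L ≃ₐ[K] L) α : L)) := by
    rw [← addVal_prod, ← hval]
    exact hv.mem_valIdeal.mp hmem
  rw [hsum] at hle
  have hmin (σ τ : (F.comap L.val).fixingSubgroup) :
      min (hv.addVal (f α - ((σ : L ≃ₐ[K] L) α : L)))
        (hv.addVal (f α - ((τ : L ≃ₐ[K] L) α : L))) ≤
      hv.addVal (((((σ⁻¹ * τ : (F.comap L.val).fixingSubgroup) : L ≃ₐ[K] L) α : L) : Ω) - α) := by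
    rw [Subgroup.coe_mul, Subgroup.coe_inv, hv.addVal_inv_mul_sub,
      ← sub_sub_sub_cancel_left _ (((τ : L ≃ₐ[K] L) α : L) : Ω) (f α)]
    exact hv.addVal.map_le_sub (min_le_left _ _) (min_le_right _ _)
  obtain ⟨σ, hσ⟩ := exists_le_of_sum_min_le
    (d := fun σ : (F.comap L.val).fixingSubgroup =>
      hv.addVal (((σ : L ≃ₐ[K] L) α : Ω) - α)) (by simp) hmin hle
  exact ⟨σ, σ.2, f α, (hint _ (hL α')).1, (hint _ (hL α')).2, hσ⟩

theorem IsCDV.homMod_of_le (hv : IsCDV K Ω v) {α : L} (hα : hv.IsGenerator α)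
    {F E : IntermediateField K Ω} (hF : F ≤ L) (hFE : F ≤ E) {J : ℝ} {σ : L ≃ₐ[K] L}
    (hσ : σ ∈ (F.comap L.val).fixingSubgroup) {β : Ω} (hβE : β ∈ E) (hβ : 0 ≤ hv.addVal β)
    (h : J ≤ hv.addVal (β - (σ α : L))) :
    HomMod v F L E (phiT v F L (ramIdx v F * J)) := by
  obtain ⟨T, hT, hsum⟩ := hv.phiT_eq hα hF J
  have hmin (σ τ : (F.comap L.val).fixingSubgroup) :
      min (hv.addVal (((((σ⁻¹ * τ : (F.comap L.val).fixingSubgroup) : L ≃ₐ[K] L) α : L) : Ω) - α))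
        (hv.addVal (β - ((σ : L ≃ₐ[K] L) α : L))) ≤
      hv.addVal (β - ((τ : L ≃ₐ[K] L) α : L)) := by
    rw [Subgroup.coe_mul, Subgroup.coe_inv, hv.addVal_inv_mul_sub,
      ← sub_sub_sub_cancel_right β (((τ : L ≃ₐ[K] L) α : L) : Ω) (((σ : L ≃ₐ[K] L) α : L) : Ω)]
    exact hv.addVal.map_le_sub (min_le_right _ _) (min_le_left _ _)
  have hle := sum_min_le_of_le
    (d := fun σ : (F.comap L.val).fixingSubgroup => hv.addVal (((σ : L ≃ₐ[K] L) α : Ω) - α))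
    hmin (ρ := ⟨σ, hσ⟩) h
  rw [← hsum] at hle
  let b : addValInts hv.addVal := ⟨β, hβ⟩
  have hroot {p : Polynomial (hv.relInts L F)} (hp : p.eval₂ (hv.relInts L F).subtype α = 0) :
      T ≤ hv.addVal (hv.relEval L F b p : Ω) := hle.trans (hα.sum_le hv hp b)
  have hex (x : Ω) : ∃ p : Polynomial (hv.relInts L F), x ∈ L ∧ 0 ≤ hv.addVal x →
      ((p.eval₂ (hv.relInts L F).subtype α : L) : Ω) = x := by
    by_cases hx : x ∈ L ∧ 0 ≤ hv.addVal x
    · obtain ⟨p, hp⟩ := hα.exists_relInts hv F (x := ⟨x, hx.1⟩) hx.2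
      exact ⟨p, fun _ => congrArg Subtype.val hp⟩
    · exact ⟨0, fun h => absurd h hx⟩
  choose P hP using hex
  refine ⟨fun x => hv.relEval L F b (P x), ?_⟩
  rw [hT, hv.isHomMod_iff hF]
  refine ⟨fun x _ => ⟨hv.relEval_mem hFE hβE _, (hv.relEval L F b (P x)).2⟩,
    fun x y hx hy => ?_, fun x y hx hy => ?_, ?_, fun c hc => ?_⟩
  · have := hroot (p := P (x + y) - (P x + P y)) (Subtype.ext ?_)
    · rw [map_sub, map_add] at this
      exact this
    · rw [Polynomial.eval₂_sub, Polynomial.eval₂_add]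
      push_cast
      rw [hP _ hx, hP _ hy, hP _ ⟨add_mem hx.1 hy.1, hv.addVal.map_le_add hx.2 hy.2⟩, sub_self]
  · have := hroot (p := P (x * y) - P x * P y) (Subtype.ext ?_)
    · rw [map_sub, _root_.map_mul] at this
      exact this
    · rw [Polynomial.eval₂_sub, Polynomial.eval₂_mul]
      push_cast
      rw [hP _ hx, hP _ hy, hP _ ⟨mul_mem hx.1 hy.1, (addValInts hv.addVal).mul_mem _ _
        hx.2 hy.2⟩, sub_self]
  · have := hroot (p := P 1 - 1) (Subtype.ext ?_)
    · rw [map_sub, _root_.map_one] at this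
      exact this
    · rw [Polynomial.eval₂_sub, Polynomial.eval₂_one]
      push_cast
      rw [hP _ ⟨one_mem L, hv.addVal.map_one.ge⟩, sub_self]
  · let c' : hv.relInts L F := ⟨⟨c, hF hc.1⟩, hc.2, hc.1⟩
    have := hroot (p := P c - Polynomial.C c') (Subtype.ext ?_)
    · have hC : hv.relEval L F b (Polynomial.C c') = hv.relIncl L F c' := Polynomial.eval₂_C _ _
      rw [map_sub, hC] at this
      exact this
    · rw [Polynomial.eval₂_sub, Polynomial.eval₂_C]
      push_cast
      rw [hP _ ⟨hF hc.1, hc.2⟩]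
      exact sub_self _

theorem IsCDV.ramFixed_le_of_le (hv : IsCDV K Ω v) [IsAlgClosure K Ω] {α : L}
    (hα : hv.IsGenerator α) {J : ℝ} (hJ : iBreak v ⊥ L = ramIdx v (⊥ : IntermediateField K Ω) * J)
    {E : IntermediateField K Ω} {β : Ω} (hβE : β ∈ E) (h : J ≤ hv.addVal (β - α)) :
    ramFixed v L ≤ E := by
  rintro x ⟨hxL, hx⟩
  have : IsAlgClosed Ω := IsAlgClosure.isAlgClosed K
  have : Algebra.IsAlgebraic K Ω := IsAlgClosure.isAlgebraic
  have : Algebra.IsAlgebraic E Ω := Algebra.IsAlgebraic.tower_top (K := K) E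
  have hsep : IsSeparable K x := by
    have h : IsSeparable K (⟨x, hxL⟩ : L) := Algebra.IsSeparable.isSeparable K _
    rwa [← isSeparable_map_iff L.val L.val.injective] at h
  suffices h : ∀ τ : Ω ≃ₐ[E] Ω, τ x = x by
    obtain ⟨y, rfl⟩ := mem_of_forall_algEquiv_eq (hsep.tower_top E) h
    exact y.2
  intro τ
  let τ' : Ω ≃ₐ[K] Ω := τ.restrictScalars K
  have hτ (z : L) : ((τ'.restrictNormal L z : L) : Ω) = τ z := τ'.restrictNormal_commutes L z
  have hlow : lowerAt v ⊥ L (τ'.restrictNormal L) (iBreak v ⊥ L) := by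
    rw [hJ, hv.lowerAt_iff hα bot_le]
    refine ⟨mem_relGal_bot _, ?_⟩
    have hτβ : τ β = β := τ.commutes ⟨β, hβE⟩
    have h' : J ≤ hv.addVal (τ (β - α)) := h.trans_eq (hv.addVal_algEquiv_top τ' _).symm
    rw [map_sub, hτβ] at h'
    rw [hτ, ← sub_sub_sub_cancel_left _ _ β]
    exact hv.addVal.map_le_sub h h'
  exact (hτ ⟨x, hxL⟩).symm.trans (congrArg Subtype.val (hx _ hlow))

end

end Fontaine

/-- Proposition 2.1. Let `L/K` be a finite Galois extension of complete
discrete valuation fields with perfect residue fields, and `M` the subfield of `L` fixed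
by `Gal(L/K)^{(u_{L/K})}`. Then `L/K` satisfies (P_m) for `m = u_{L/K}` iff `L/M`
satisfies (P_m) for `m = u_{L/M}`. -/
theorem statement1
    (K Ω : Type) [Field K] [Field Ω] [Algebra K Ω] [IsAlgClosure K Ω]
    (v : Ω → ℝ) (hv : IsCDV K Ω v) (hperf : PerfectResidue v K)
    (L : IntermediateField K Ω) [FiniteDimensional K ↥L] [IsGalois K ↥L] :
    PropP v ⊥ L (uBreak v ⊥ L) ↔
      PropP v (ramFixed v L) L (uBreak v (ramFixed v L) L) := by
  obtain ⟨α, hα⟩ := hv.exists_isGenerator hperf (L := L)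
  obtain ⟨J, hbot, hfix⟩ := hv.exists_iBreak_eq hα
  rw [uBreak, uBreak, hbot, hfix]
  refine ⟨fun hP E _ hE => ?_, fun hP E _ hE => ?_⟩
  · obtain ⟨σ, -, β, hβE, hβ, hle⟩ := hv.exists_le_of_homMod hα ramFixed_le hE
    exact hP E bot_le (hv.homMod_of_le hα bot_le bot_le
      (mem_relGal.mp (mem_relGal_bot σ)) hβE hβ hle)
  · obtain ⟨σ, -, β, hβE, hβ, hle⟩ := hv.exists_le_of_homMod hα bot_le hE
    have hσ := hα.algEquiv hv σ
    have hM := hv.ramFixed_le_of_le hσ hbot hβE hle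
    exact hP E hM (hv.homMod_of_le hσ ramFixed_le hM (one_mem _) hβE hβ hle)
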